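/- A vector f ∈ ℕ^{2n} is the run profile of the run of the train from o to d (in particular, the run terminates) if and only if f is a switching flow from o to d, f_{(d,s0(d))} = f_{(d,s1(d))} = 0, and the graph of last-used edges G*_f contains no directed cycle. Consequently, there is at most one switching flow from o to d with these properties, and one exists if and only if the run from o to d terminates. -/

import Mathlib

/-- One step of the train process: from a configuration (position, current switch
settings), the train moves along the current switch edge of its position and that
switch flips. `false` stands for the switch `s0`, `true` for `s1`. -/
def trainStep {V : Type} [DecidableEq V] (s : Bool → V → V) (st : V × (V → Bool)) :
    V × (V → Bool) :=
  (s (st.2 st.1) st.1, Function.update st.2 st.1 (!(st.2 st.1)))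

/-- Configuration (position, switch settings) of the run of the train from `o` to `d`
after `k` steps; the train starts at `o` with all switches set to `s0` and the process
stops when the train first reaches `d`. -/
def runState {V : Type} [DecidableEq V] (s : Bool → V → V) (o d : V) : ℕ → V × (V → Bool)
  | 0 => (o, fun _ => false)
  | k + 1 =>
      if (runState s o d k).1 = d then runState s o d k
      else trainStep s (runState s o d k)

/-- The partial run profile after `k` steps of the run of the train from `o` to `d`:
for each edge `(v, s b v)` (encoded by the pair `v`, `b`) the number of times the train
has traversed it during the first `k` steps. -/
def runProfile {V : Type} [DecidableEq V] (s : Bool → V → V) (o d : V) : ℕ → V → Bool → ℕ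
  | 0 => fun _ _ => 0
  | k + 1 =>
      if (runState s o d k).1 = d then runProfile s o d k
      else fun v b =>
        runProfile s o d k v b +
          if v = (runState s o d k).1 ∧ b = (runState s o d k).2 (runState s o d k).1
          then 1 else 0

/-- `f : V → Bool → ℕ` (where `f v b` is the value on the edge `(v, s b v)`) is a
switching flow from `o` to `v`: Kirchhoff's law and the parity condition hold. -/
def IsSwitchingFlow {V : Type} [Fintype V] [DecidableEq V] (s : Bool → V → V)
    (o v : V) (f : V → Bool → ℕ) : Prop :=
  (∀ u : V,
      ((∑ w : V, ∑ b : Bool, if s b w = u then (f w b : ℤ) else 0)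
          - ((f u false : ℤ) + (f u true : ℤ)))
        = (if u = v then 1 else 0) - (if u = o then 1 else 0)) ∧
  (∀ u : V, f u true ≤ f u false ∧ f u false ≤ f u true + 1)

/-- The edge `(v, s b v)` belongs to the graph of last-used edges `G*_f`. -/
def LastUsed {V : Type} (f : V → Bool → ℕ) (v : V) (b : Bool) : Prop :=
  (b = false ∧ f v false ≠ f v true) ∨ (b = true ∧ f v false = f v true ∧ 0 < f v true)

/-- Adjacency of the graph of last-used edges `G*_f`. -/
def GstarAdj {V : Type} (s : Bool → V → V) (f : V → Bool → ℕ) (u w : V) : Prop :=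
  ∃ b : Bool, LastUsed f u b ∧ s b u = w

/-- `c` is a directed cycle of the binary relation `adj`: a nonempty list of pairwise
distinct vertices with `adj` holding along the list cyclically. -/
def IsCycle {V : Type} (adj : V → V → Prop) (c : List V) : Prop :=
  c ≠ [] ∧ c.Nodup ∧
    ∀ i : Fin c.length, adj (c.get i) (c.get ⟨(i.1 + 1) % c.length, Nat.mod_lt _ i.pos⟩)

theorem not_isCycle_of_rank {V : Type} {adj : V → V → Prop} (t : V → ℕ)
    (ht : ∀ u v w, adj u v → adj v w → t u < t v) (c : List V) : ¬ IsCycle adj c := by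
  rintro ⟨hne, -, hadj⟩
  have : Nonempty (Fin c.length) := ⟨⟨0, List.length_pos_of_ne_nil hne⟩⟩
  obtain ⟨i, hi⟩ := Finite.exists_max fun i : Fin c.length => t (c.get i)
  exact absurd (ht _ _ _ (hadj i) (hadj _)) (not_lt.mpr (hi _))

theorem exists_isCycle_of_iterate {V : Type} [Finite V] {adj : V → V → Prop} (g : V → V) (x : V)
    (hg : ∀ n, adj (g^[n] x) (g^[n + 1] x)) : ∃ c, IsCycle adj c := by
  obtain ⟨m, n, hmn, heq⟩ : ∃ m n, m < n ∧ g^[m] x = g^[n] x := by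
    obtain ⟨m, n, hne, heq⟩ := Finite.exists_ne_map_eq_of_infinite fun n : ℕ => g^[n] x
    rcases hne.lt_or_gt with h | h
    exacts [⟨m, n, h, heq⟩, ⟨n, m, h, heq.symm⟩]
  set y := g^[m] x with hy
  have hper : y ∈ Function.periodicPts g := by
    refine ⟨n - m, by omega, ?_⟩
    rw [Function.IsPeriodicPt, Function.IsFixedPt, hy, ← Function.iterate_add_apply,
      Nat.sub_add_cancel hmn.le, ← heq]
  have hpos := Function.minimalPeriod_pos_of_mem_periodicPts hper
  have hadj : ∀ k, adj (g^[k] y) (g^[k + 1] y) := fun k => by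
    rw [hy, ← Function.iterate_add_apply, ← Function.iterate_add_apply,
      show k + 1 + m = k + m + 1 by omega]
    exact hg _
  refine ⟨(List.range (Function.minimalPeriod g y)).map (g^[·] y), ?_, ?_, fun i => ?_⟩
  · simpa using hpos.ne'
  · refine List.Nodup.map_on (fun a ha b hb hab => ?_) List.nodup_range
    exact Function.iterate_injOn_Iio_minimalPeriod (List.mem_range.mp ha) (List.mem_range.mp hb) hab
  · simpa [Function.iterate_mod_minimalPeriod_eq] using hadj i

section Run

variable {V : Type} [DecidableEq V] (s : Bool → V → V) (o d : V)

theorem runProfile_parity (k : ℕ) (u : V) :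
    runProfile s o d k u false
      = runProfile s o d k u true + if (runState s o d k).2 u then 1 else 0 := by
  induction k with
  | zero => simp [runProfile, runState]
  | succ k ih =>
    by_cases h : (runState s o d k).1 = d
    · simpa [runProfile, runState, h] using ih
    · by_cases hu : u = (runState s o d k).1
      · subst hu
        cases hσ : (runState s o d k).2 (runState s o d k).1 <;>
          simp_all [runProfile, runState, trainStep]
      · simpa [runProfile, runState, trainStep, h, hu] using ih

theorem runProfile_destination (k : ℕ) (b : Bool) : runProfile s o d k d b = 0 := by
  induction k with
  | zero => rfl
  | succ k ih =>
    by_cases h : (runState s o d k).1 = d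
    · simpa [runProfile, h] using ih
    · simp [runProfile, h, ih, Ne.symm h]

theorem lastUsed_runProfile_iff (k : ℕ) (u : V) (b : Bool) :
    LastUsed (runProfile s o d k) u b ↔
      b = !(runState s o d k).2 u ∧ 0 < runProfile s o d k u false := by
  have h := runProfile_parity s o d k u
  unfold LastUsed
  cases hσ : (runState s o d k).2 u <;> cases b <;> simp_all

theorem exists_rank_runProfile (k : ℕ) :
    ∃ t : V → ℕ, (∀ u, t u ≤ k) ∧
      ∀ u w, GstarAdj s (runProfile s o d k) u w → w ≠ (runState s o d k).1 → t u < t w := by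
  induction k with
  | zero =>
    refine ⟨fun _ => 0, fun _ => le_rfl, ?_⟩
    rintro u w ⟨b, hb, -⟩
    simp [LastUsed, runProfile] at hb
  | succ k ih =>
    obtain ⟨t, htk, ht⟩ := ih
    by_cases h : (runState s o d k).1 = d
    · refine ⟨t, fun u => (htk u).trans k.le_succ, ?_⟩
      simpa [runProfile, runState, h] using ht
    refine ⟨Function.update t (runState s o d k).1 (k + 1), fun u => ?_, ?_⟩
    · by_cases hu : u = (runState s o d k).1
      · simp [hu]
      · simpa [hu] using (htk u).trans k.le_succ
    rintro u w ⟨b, hb, rfl⟩ hw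
    have hb' := (lastUsed_runProfile_iff s o d (k + 1) u b).mp hb
    by_cases hu : u = (runState s o d k).1
    · subst hu
      exact absurd (by simp [hb'.1, runState, trainStep, h]) hw
    have hlast : LastUsed (runProfile s o d k) u b := by
      simpa [LastUsed, runProfile, h, hu] using hb
    by_cases hwp : s b u = (runState s o d k).1
    · simpa [hu, hwp] using Nat.lt_succ_of_le (htk u)
    · simpa [hu, hwp] using ht u _ ⟨b, hlast, rfl⟩ hwp

theorem not_isCycle_runProfile (k : ℕ) (hk : (runState s o d k).1 = d) (c : List V) :
    ¬ IsCycle (GstarAdj s (runProfile s o d k)) c := by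
  obtain ⟨t, -, ht⟩ := exists_rank_runProfile s o d k
  refine not_isCycle_of_rank t (fun u v w huv hvw => ht u v huv ?_) c
  rintro rfl
  obtain ⟨b, hb, -⟩ := hvw
  rw [hk] at hb
  simp [LastUsed, runProfile_destination] at hb

variable [Fintype V]

theorem isSwitchingFlow_runProfile (k : ℕ) :
    IsSwitchingFlow s o (runState s o d k).1 (runProfile s o d k) := by
  refine ⟨fun u => ?_, fun u => ?_⟩
  swap
  · have := runProfile_parity s o d k u
    split_ifs at this <;> omega
  induction k with
  | zero =>
    by_cases hu : u = o <;> simp [runProfile, runState, hu]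
  | succ k ih =>
    by_cases h : (runState s o d k).1 = d
    · simpa [runProfile, runState, h] using ih
    set p := (runState s o d k).1 with hp
    set σ := (runState s o d k).2 with hσ
    set r := runProfile s o d k with hr
    have hstep : ∀ v b, (runProfile s o d (k + 1) v b : ℤ)
        = r v b + if v = p ∧ b = σ p then 1 else 0 := fun v b => by
      simp [runProfile, ← hp, ← hσ, ← hr, h]
    have hpos : (runState s o d (k + 1)).1 = s (σ p) p := by
      simp [runState, trainStep, ← hp, ← hσ, h]
    have hin : (∑ w : V, ∑ b : Bool,
          if s b w = u then (runProfile s o d (k + 1) w b : ℤ) else 0)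
        = (∑ w : V, ∑ b : Bool, if s b w = u then (r w b : ℤ) else 0)
          + if u = s (σ p) p then 1 else 0 := by
      have hind : (∑ w : V, ∑ b : Bool,
          if s b w = u then (if w = p ∧ b = σ p then (1 : ℤ) else 0) else 0)
            = if u = s (σ p) p then 1 else 0 := by
        rw [Finset.sum_eq_single p, Finset.sum_eq_single (σ p)]
        · simp [eq_comm]
        · intro b _ hb
          simp [hb]
        · simp
        · intro w _ hw
          simp [hw]
        · simp
      rw [← hind, ← Finset.sum_add_distrib]
      refine Finset.sum_congr rfl fun w _ => ?_
      rw [← Finset.sum_add_distrib]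
      refine Finset.sum_congr rfl fun b _ => ?_
      rw [hstep]
      split_ifs <;> simp
    have hout : (runProfile s o d (k + 1) u false : ℤ) + runProfile s o d (k + 1) u true
        = r u false + r u true + if u = p then 1 else 0 := by
      rw [hstep, hstep]
      cases σ p <;> by_cases hu : u = p <;> simp [hu] <;> ring
    rw [hin, hout, hpos]
    linarith

theorem isSwitchingFlow_runProfile_of_eq (k : ℕ) (hk : (runState s o d k).1 = d) :
    IsSwitchingFlow s o d (runProfile s o d k) := by
  have h := isSwitchingFlow_runProfile s o d k
  rwa [hk] at h

end Run

section SwitchingFlow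

variable {V : Type} [Fintype V] [DecidableEq V] {s : Bool → V → V} {o d v : V}
  {f r : V → Bool → ℕ}

theorem IsSwitchingFlow.sum_sub (hf : IsSwitchingFlow s o d f) (hr : IsSwitchingFlow s o v r)
    (u : V) :
    (f u false + f u true : ℤ) - (r u false + r u true)
      = (∑ w : V, ∑ b : Bool, if s b w = u then (f w b - r w b : ℤ) else 0)
        - (if u = d then 1 else 0) + (if u = v then 1 else 0) := by
  have h : (∑ w : V, ∑ b : Bool, if s b w = u then (f w b - r w b : ℤ) else 0)
      = (∑ w : V, ∑ b : Bool, if s b w = u then (f w b : ℤ) else 0)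
        - ∑ w : V, ∑ b : Bool, if s b w = u then (r w b : ℤ) else 0 := by
    simp only [← Finset.sum_sub_distrib]
    refine Finset.sum_congr rfl fun w _ => Finset.sum_congr rfl fun b _ => ?_
    split_ifs <;> simp
  rw [h]
  linarith [hf.1 u, hr.1 u]

theorem IsSwitchingFlow.outflow_lt (hf : IsSwitchingFlow s o d f) (hr : IsSwitchingFlow s o v r)
    (hle : ∀ u b, r u b ≤ f u b) (hvd : v ≠ d) :
    r v false + r v true < f v false + f v true := by
  have h := hf.sum_sub hr v
  have hnn : (0 : ℤ) ≤ ∑ w : V, ∑ b : Bool, if s b w = v then (f w b - r w b : ℤ) else 0 :=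
    Finset.sum_nonneg fun w _ => Finset.sum_nonneg fun b _ => by
      have := hle w b
      split_ifs <;> omega
  simp only [hvd, if_true, if_false] at h
  omega

theorem IsSwitchingFlow.outflow_lt_of_edge (hf : IsSwitchingFlow s o d f)
    (hr : IsSwitchingFlow s o d r) (hle : ∀ u b, r u b ≤ f u b) {u : V} {b : Bool}
    (hub : r u b < f u b) :
    r (s b u) false + r (s b u) true < f (s b u) false + f (s b u) true := by
  have h := hf.sum_sub hr (s b u)
  have hnn : ∀ w c, (0 : ℤ) ≤ if s c w = s b u then (f w c - r w c : ℤ) else 0 := fun w c => by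
    have := hle w c
    split_ifs <;> omega
  have hedge : (f u b - r u b : ℤ)
      ≤ ∑ w : V, ∑ c : Bool, if s c w = s b u then (f w c - r w c : ℤ) else 0 := by
    calc (f u b - r u b : ℤ) = if s b u = s b u then (f u b - r u b : ℤ) else 0 := by simp
      _ ≤ ∑ c : Bool, if s c u = s b u then (f u c - r u c : ℤ) else 0 :=
        Finset.single_le_sum (f := fun c => if s c u = s b u then (f u c - r u c : ℤ) else 0)
          (fun c _ => hnn u c) (Finset.mem_univ b)
      _ ≤ _ := Finset.single_le_sum
          (f := fun w => ∑ c : Bool, if s c w = s b u then (f w c - r w c : ℤ) else 0)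
          (fun w _ => Finset.sum_nonneg fun c _ => hnn w c) (Finset.mem_univ u)
  omega

theorem IsSwitchingFlow.exists_lastUsed (hf : IsSwitchingFlow s o d f)
    (hr : IsSwitchingFlow s o v r) {u : V}
    (hu : r u false + r u true < f u false + f u true) :
    ∃ b, LastUsed f u b ∧ r u b < f u b := by
  have h1 := hf.2 u
  have h2 := hr.2 u
  by_cases h : f u false = f u true
  · exact ⟨true, Or.inr ⟨rfl, h, by omega⟩, by omega⟩
  · exact ⟨false, Or.inl ⟨rfl, h⟩, by omega⟩

theorem IsSwitchingFlow.eq_of_le_of_acyclic (hf : IsSwitchingFlow s o d f)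
    (hr : IsSwitchingFlow s o d r) (hle : ∀ u b, r u b ≤ f u b)
    (hc : ∀ c, ¬ IsCycle (GstarAdj s f) c) : f = r := by
  by_contra hne
  obtain ⟨x, hx⟩ : ∃ x, r x false + r x true < f x false + f x true := by
    by_contra! hall
    refine hne (funext fun u => funext fun b => ?_)
    have := hall u
    have := hle u false
    have := hle u true
    cases b <;> omega
  have hnext : ∀ u, ∃ w, r u false + r u true < f u false + f u true →
      GstarAdj s f u w ∧ r w false + r w true < f w false + f w true := fun u => by
    by_cases hu : r u false + r u true < f u false + f u true
    · obtain ⟨b, hb, hlt⟩ := hf.exists_lastUsed hr hu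
      exact ⟨s b u, fun _ => ⟨⟨b, hb, rfl⟩, hf.outflow_lt_of_edge hr hle hlt⟩⟩
    · exact ⟨u, fun h => absurd h hu⟩
  choose g hg using hnext
  have hiter : ∀ n, r (g^[n] x) false + r (g^[n] x) true
      < f (g^[n] x) false + f (g^[n] x) true := fun n => by
    induction n with
    | zero => exact hx
    | succ n ih =>
      rw [Function.iterate_succ_apply']
      exact (hg _ ih).2
  obtain ⟨c, hcyc⟩ := exists_isCycle_of_iterate (adj := GstarAdj s f) g x fun n => by
    rw [Function.iterate_succ_apply']
    exact (hg _ (hiter n)).1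
  exact hc c hcyc

theorem IsSwitchingFlow.runProfile_le (hf : IsSwitchingFlow s o d f) (k : ℕ) (u : V) (b : Bool) :
    runProfile s o d k u b ≤ f u b := by
  induction k generalizing u b with
  | zero => exact Nat.zero_le _
  | succ k ih =>
    by_cases h : (runState s o d k).1 = d
    · simpa [runProfile, h] using ih u b
    have hlt := hf.outflow_lt (isSwitchingFlow_runProfile s o d k) ih h
    have hpar := runProfile_parity s o d k (runState s o d k).1
    have hfpar := hf.2 (runState s o d k).1
    simp only [runProfile, h, if_false]
    split_ifs with hub
    · obtain ⟨rfl, rfl⟩ := hub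
      cases hσ : (runState s o d k).2 (runState s o d k).1 <;> simp [hσ] at hpar <;> omega
    · exact ih u b

theorem le_sum_runProfile (k : ℕ) (hk : ∀ j < k, (runState s o d j).1 ≠ d) :
    k ≤ ∑ u : V, ∑ b : Bool, runProfile s o d k u b := by
  induction k with
  | zero => exact Nat.zero_le _
  | succ k ih =>
    refine Nat.succ_le_of_lt ((ih fun j hj => hk j (by omega)).trans_lt ?_)
    have h := hk k k.lt_succ_self
    have hle : ∀ u b, runProfile s o d k u b ≤ runProfile s o d (k + 1) u b := fun u b => by
      simp [runProfile, h]
    refine Finset.sum_lt_sum (fun u _ => Finset.sum_le_sum fun b _ => hle u b)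
      ⟨(runState s o d k).1, Finset.mem_univ _, ?_⟩
    refine Finset.sum_lt_sum (fun b _ => hle _ b)
      ⟨(runState s o d k).2 (runState s o d k).1, Finset.mem_univ _, ?_⟩
    simp [runProfile, h]

theorem IsSwitchingFlow.run_terminates (hf : IsSwitchingFlow s o d f) :
    ∃ k, (runState s o d k).1 = d := by
  by_contra! h
  have hlow := le_sum_runProfile (∑ u : V, ∑ b : Bool, f u b + 1) fun j _ => h j
  have hup := Finset.sum_le_sum fun u (_ : u ∈ Finset.univ) =>
    Finset.sum_le_sum fun b (_ : b ∈ Finset.univ) =>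
      hf.runProfile_le ((∑ u : V, ∑ b : Bool, f u b) + 1) u b
  omega

theorem IsSwitchingFlow.eq_runProfile (hf : IsSwitchingFlow s o d f)
    (hc : ∀ c, ¬ IsCycle (GstarAdj s f) c) {k : ℕ} (hk : (runState s o d k).1 = d) :
    f = runProfile s o d k :=
  hf.eq_of_le_of_acyclic (isSwitchingFlow_runProfile_of_eq s o d k hk) (hf.runProfile_le k) hc

end SwitchingFlow

/-- A vector `f` is the run profile of the (terminating) run of the
train from `o` to `d` iff `f` is a switching flow from `o` to `d`, `f` vanishes on both
outgoing edges of `d`, and `G*_f` contains no directed cycle. Consequently, there is at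
most one switching flow from `o` to `d` with these properties, and one exists iff the
run from `o` to `d` terminates. -/
theorem run_profile_iff_acyclic_switching_flow
    {V : Type} [Fintype V] [DecidableEq V] (s : Bool → V → V) (o d : V)
    (hd0 : s false d = d) (hd1 : s true d = d) :
    (∀ f : V → Bool → ℕ,
      (∃ k : ℕ, (runState s o d k).1 = d ∧ f = runProfile s o d k) ↔
        (IsSwitchingFlow s o d f ∧ f d false = 0 ∧ f d true = 0 ∧
          ∀ c : List V, ¬ IsCycle (GstarAdj s f) c)) ∧
    (∀ f g : V → Bool → ℕ,
      (IsSwitchingFlow s o d f ∧ f d false = 0 ∧ f d true = 0 ∧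
        ∀ c : List V, ¬ IsCycle (GstarAdj s f) c) →
      (IsSwitchingFlow s o d g ∧ g d false = 0 ∧ g d true = 0 ∧
        ∀ c : List V, ¬ IsCycle (GstarAdj s g) c) →
      f = g) ∧
    ((∃ f : V → Bool → ℕ, IsSwitchingFlow s o d f ∧ f d false = 0 ∧ f d true = 0 ∧
        ∀ c : List V, ¬ IsCycle (GstarAdj s f) c) ↔
      (∃ k : ℕ, (runState s o d k).1 = d)) := by
  have hrun : ∀ k, (runState s o d k).1 = d →
      IsSwitchingFlow s o d (runProfile s o d k) ∧ runProfile s o d k d false = 0 ∧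
        runProfile s o d k d true = 0 ∧
        ∀ c : List V, ¬ IsCycle (GstarAdj s (runProfile s o d k)) c := fun k hk =>
    ⟨isSwitchingFlow_runProfile_of_eq s o d k hk, runProfile_destination s o d k _,
      runProfile_destination s o d k _, not_isCycle_runProfile s o d k hk⟩
  refine ⟨fun f => ⟨?_, ?_⟩, ?_, ?_, ?_⟩
  · rintro ⟨k, hk, rfl⟩
    exact hrun k hk
  · rintro ⟨hf, -, -, hc⟩
    obtain ⟨k, hk⟩ := hf.run_terminates
    exact ⟨k, hk, hf.eq_runProfile hc hk⟩
  · rintro f g ⟨hf, -, -, hcf⟩ ⟨hg, -, -, hcg⟩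
    obtain ⟨k, hk⟩ := hf.run_terminates
    exact (hf.eq_runProfile hcf hk).trans (hg.eq_runProfile hcg hk).symm
  · rintro ⟨f, hf, -⟩
    exact hf.run_terminates
  · rintro ⟨k, hk⟩
    exact ⟨_, hrun k hk⟩
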